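/- There is no K₃,₃-configuration in the plane: one cannot choose disjoint three-element sets U, V ⊆ ℝ² and nine continuous arcs f_{u,v} (u ∈ U, v ∈ V), each joining u to v, such that the interiors f_{u,v}⁰ are pairwise disjoint and disjoint from U ∪ V. Equivalently, the graph K₃,₃ is not planar. -/

import Mathlib

/-- An arc on `[0,1]`: a continuous injection. -/
def IsArc01 (f : ℝ → ℝ × ℝ) : Prop :=
  ContinuousOn f (Set.Icc (0 : ℝ) 1) ∧ Set.InjOn f (Set.Icc (0 : ℝ) 1)

/-- Nonvanishing continuous functions on the plane have continuous logarithms. -/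
lemma exists_clog (F : ℝ × ℝ → ℂ) (hF : Continuous F) (h0 : ∀ x, F x ≠ 0) :
    ∃ L : ℝ × ℝ → ℂ, Continuous L ∧ ∀ x, Complex.exp (L x) = F x := by
  obtain ⟨L, ⟨-, hL⟩, -⟩ := Complex.isCoveringMapOn_exp.existsUnique_continuousMap_lifts
    (A := ℝ × ℝ) ⟨F, hF⟩ (a₀ := (0, 0)) (e₀ := Complex.log (F (0, 0)))
    (by simpa using Complex.exp_log (h0 _)) (fun a => by simpa using h0 a)
  exact ⟨L, L.continuous, fun x => congrFun hL x⟩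

/-- The change of the logarithm along a path is determined up to the fixed endpoint logarithms
and one integer depending only on the path. -/
lemma exists_turn (γ : ℝ → ℂ) (b0 b1 : ℂ) (h0 : Complex.exp b0 = γ 0)
    (h1 : Complex.exp b1 = γ 1) :
    ∃ n : ℤ, ∀ g : ℝ → ℂ, Continuous g → (∀ t, Complex.exp (g t) = γ t) →
      g 1 - g 0 = b1 - b0 + n * (2 * Real.pi * Complex.I) := by
  by_cases hex : ∃ g : ℝ → ℂ, Continuous g ∧ ∀ t, Complex.exp (g t) = γ t
  · obtain ⟨g, hg, hgl⟩ := hex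
    obtain ⟨n0, hn0⟩ := Complex.exp_eq_exp_iff_exists_int.1 ((hgl 0).trans h0.symm)
    obtain ⟨n1, hn1⟩ := Complex.exp_eq_exp_iff_exists_int.1 ((hgl 1).trans h1.symm)
    refine ⟨n1 - n0, fun k hk hkl => ?_⟩
    obtain ⟨m, hm⟩ := Complex.exp_eq_exp_iff_exists_int.1 ((hkl 0).trans (hgl 0).symm)
    have heq : k = fun t => g t + m * (2 * Real.pi * Complex.I) := by
      refine Complex.isCoveringMap_exp.eq_of_comp_eq hk (by fun_prop) ?_ 0 hm
      funext t
      apply Subtype.ext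
      change Complex.exp (k t) = Complex.exp (g t + m * (2 * Real.pi * Complex.I))
      rw [hkl, ← hgl]
      exact Complex.exp_eq_exp_iff_exists_int.2 ⟨-m, by push_cast; ring⟩
    rw [heq]
    simp only [hn0, hn1]
    push_cast
    ring
  · exact ⟨0, fun g hg hgl => (hex ⟨g, hg, hgl⟩).elim⟩

/-- Compatible logarithms of differences of three distinct points. -/
lemma exists_difflog (u : Fin 3 → ℂ) (hu : ∀ i i', i ≠ i' → u i ≠ u i') :
    ∃ B : Fin 3 → Fin 3 → ℂ, (∀ i i', i ≠ i' → Complex.exp (B i i') = u i' - u i) ∧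
      ∀ i i', i < i' → B i' i = B i i' + Real.pi * Complex.I := by
  refine ⟨fun i i' => if i < i' then Complex.log (u i' - u i)
    else Complex.log (u i - u i') + Real.pi * Complex.I, ?_, ?_⟩
  · intro i i' h
    dsimp only
    split_ifs
    · exact Complex.exp_log (sub_ne_zero.2 (hu _ _ h.symm))
    · rw [Complex.exp_add, Complex.exp_pi_mul_I, Complex.exp_log (sub_ne_zero.2 (hu _ _ h))]
      ring
  · intro i i' h
    simp [h, not_lt.2 h.le]

/-- Any continuous map of `K₃,₃` to the plane makes two independent edges meet. -/
theorem K33_core (u v : Fin 3 → ℂ) (f : Fin 3 → Fin 3 → ℝ → ℂ)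
    (hc : ∀ i j, Continuous (f i j)) (h0 : ∀ i j, f i j 0 = u i) (h1 : ∀ i j, f i j 1 = v j)
    (hd : ∀ i i' j j', i ≠ i' → j ≠ j' → ∀ s t, f i j s ≠ f i' j' t) : False := by
  have hother : ∀ j : Fin 3, ∃ j', j ≠ j' := by decide
  have huu : ∀ i i', i ≠ i' → u i ≠ u i' := by
    intro i i' h
    simpa [h0] using hd i i' 0 1 h (by decide) 0 0
  have hvv : ∀ i i', i ≠ i' → v i ≠ v i' := by
    intro i i' h
    simpa [h1] using hd 0 1 i i' (by decide) h 1 1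
  have huv : ∀ i j, v j ≠ u i := by
    intro i j
    obtain ⟨i', hi⟩ := hother i
    obtain ⟨j', hj⟩ := hother j
    have := hd i' i j j' hi.symm hj 1 0
    rwa [h0, h1] at this
  obtain ⟨B, hB, hB'⟩ := exists_difflog u huu
  obtain ⟨C, hC, hC'⟩ := exists_difflog v hvv
  obtain ⟨A, hA⟩ : ∃ A : Fin 3 → Fin 3 → ℂ, ∀ i j, Complex.exp (A i j) = v j - u i :=
    ⟨fun i j => Complex.log (v j - u i), fun i j => Complex.exp_log (sub_ne_zero.2 (huv i j))⟩
  have hU : ∀ i i' j', ∃ n : ℤ, i ≠ i' → ∀ g : ℝ → ℂ, Continuous g →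
      (∀ t, Complex.exp (g t) = f i' j' t - u i) →
      g 1 - g 0 = A i j' - B i i' + n * (2 * Real.pi * Complex.I) := by
    intro i i' j'
    by_cases h : i = i'
    · exact ⟨0, fun h' => (h' h).elim⟩
    · obtain ⟨n, hn⟩ := exists_turn (fun t => f i' j' t - u i) (B i i') (A i j')
        (by simp only [h0, hB i i' h]) (by simp only [h1, hA])
      exact ⟨n, fun _ => hn⟩
  have hV : ∀ j i' j', ∃ n : ℤ, j ≠ j' → ∀ g : ℝ → ℂ, Continuous g →
      (∀ t, Complex.exp (g t) = f i' j' t - v j) →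
      g 1 - g 0 = C j j' - (A i' j + Real.pi * Complex.I) + n * (2 * Real.pi * Complex.I) := by
    intro j i' j'
    by_cases h : j = j'
    · exact ⟨0, fun h' => (h' h).elim⟩
    · obtain ⟨n, hn⟩ := exists_turn (fun t => f i' j' t - v j) (A i' j + Real.pi * Complex.I)
        (C j j') (by simp only [h0, Complex.exp_add, hA, Complex.exp_pi_mul_I]; ring)
        (by simp only [h1, hC j j' h])
      exact ⟨n, fun _ => hn⟩
  choose nU hnU using hU
  choose nV hnV using hV
  have key : ∀ i i' j j', i ≠ i' → j ≠ j' →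
      (B i' i - B i i') + (C j' j - C j j') + ((nU i i' j' + nV j' i j - nV j i' j' - nU i' i j : ℤ)
        : ℂ) * (2 * Real.pi * Complex.I) = 0 := by
    intro i i' j j' hi hj
    obtain ⟨L, hL, hLe⟩ := exists_clog (fun x => f i j x.1 - f i' j' x.2)
      (((hc i j).comp continuous_fst).sub ((hc i' j').comp continuous_snd))
      (fun x => sub_ne_zero.2 (hd i i' j j' hi hj x.1 x.2))
    have e1 := hnU i i' j' hi (fun t => L (0, t) + Real.pi * Complex.I) (by fun_prop) (by
      intro t
      simp only [Complex.exp_add, hLe, Complex.exp_pi_mul_I, h0]; ring)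
    have e2 := hnV j i' j' hj (fun t => L (1, t) + Real.pi * Complex.I) (by fun_prop) (by
      intro t
      simp only [Complex.exp_add, hLe, Complex.exp_pi_mul_I, h1]; ring)
    have e3 := hnU i' i j hi.symm (fun t => L (t, 0)) (by fun_prop) (by
      intro t
      simp only [hLe, h0])
    have e4 := hnV j' i j hj.symm (fun t => L (t, 1)) (by fun_prop) (by
      intro t
      simp only [hLe, h1])
    push_cast
    linear_combination e2 + e3 - e1 - e4
  have hpi : (2 * Real.pi * Complex.I : ℂ) ≠ 0 := Complex.two_pi_I_ne_zero
  have key1 : ∀ i i' j j', i < i' → j < j' →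
      1 + nU i i' j' + nV j' i j - nV j i' j' - nU i' i j = 0 := by
    intro i i' j j' hi hj
    have := key i i' j j' hi.ne hj.ne
    rw [hB' i i' hi, hC' j j' hj] at this
    have h2 : ((1 + nU i i' j' + nV j' i j - nV j i' j' - nU i' i j : ℤ) : ℂ)
        * (2 * Real.pi * Complex.I) = 0 := by
      push_cast at this ⊢
      linear_combination this
    exact_mod_cast (mul_eq_zero.1 h2).resolve_right hpi
  have key2 : ∀ i i' j j', i < i' → j' < j →
      nU i i' j' + nV j' i j - nV j i' j' - nU i' i j = 0 := by
    intro i i' j j' hi hj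
    have := key i i' j j' hi.ne hj.ne'
    rw [hB' i i' hi, hC' j' j hj] at this
    have h2 : ((nU i i' j' + nV j' i j - nV j i' j' - nU i' i j : ℤ) : ℂ)
        * (2 * Real.pi * Complex.I) = 0 := by
      push_cast at this ⊢
      linear_combination this
    exact_mod_cast (mul_eq_zero.1 h2).resolve_right hpi
  have l01 : (0 : Fin 3) < 1 := by decide
  have l02 : (0 : Fin 3) < 2 := by decide
  have l12 : (1 : Fin 3) < 2 := by decide
  have pr : ∀ i i', i < i' → ∃ m : ℤ, 3 + 2 * m + (nU i i' 0 + nU i i' 1 + nU i i' 2) * 2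
      + (nV 0 i 1 + nV 0 i 2 + nV 1 i 0 + nV 1 i 2 + nV 2 i 0 + nV 2 i 1)
      - (nV 0 i' 1 + nV 0 i' 2 + nV 1 i' 0 + nV 1 i' 2 + nV 2 i' 0 + nV 2 i' 1) = 0 := by
    intro i i' h
    refine ⟨-(nU i' i 0 + nU i' i 1 + nU i' i 2), ?_⟩
    linarith [key1 i i' 0 1 h l01, key1 i i' 0 2 h l02, key1 i i' 1 2 h l12,
      key2 i i' 1 0 h l01, key2 i i' 2 0 h l02, key2 i i' 2 1 h l12]
  obtain ⟨m1, q1⟩ := pr 0 1 l01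
  obtain ⟨m2, q2⟩ := pr 0 2 l02
  obtain ⟨m3, q3⟩ := pr 1 2 l12
  omega

/-- There is no `K₃,₃`-configuration in the plane: `K₃,₃` is not planar. -/
theorem no_K33_configuration :
    ¬ ∃ (U V : Finset (ℝ × ℝ)) (F : ℝ × ℝ → ℝ × ℝ → ℝ → ℝ × ℝ),
      U.card = 3 ∧ V.card = 3 ∧ Disjoint U V ∧
      (∀ u ∈ U, ∀ v ∈ V, IsArc01 (F u v) ∧ F u v 0 = u ∧ F u v 1 = v) ∧
      (∀ u ∈ U, ∀ v ∈ V, ∀ u' ∈ U, ∀ v' ∈ V, (u, v) ≠ (u', v') →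
        (F u v '' Set.Ioo 0 1) ∩ (F u' v' '' Set.Ioo 0 1) = ∅) ∧
      (∀ u ∈ U, ∀ v ∈ V,
        (F u v '' Set.Ioo 0 1) ∩ (↑U ∪ ↑V : Set (ℝ × ℝ)) = ∅) := by
  rintro ⟨U, V, F, hU, hV, hUV, hF, hdis, hint⟩
  obtain ⟨u, hu, huU⟩ : ∃ u : Fin 3 → ℝ × ℝ, Function.Injective u ∧ ∀ i, u i ∈ U :=
    ⟨fun i => ((U.equivFinOfCardEq hU).symm i : ℝ × ℝ),
      fun a b h => (U.equivFinOfCardEq hU).symm.injective (Subtype.ext h), fun i => Subtype.prop _⟩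
  obtain ⟨v, hv, hvV⟩ : ∃ v : Fin 3 → ℝ × ℝ, Function.Injective v ∧ ∀ i, v i ∈ V :=
    ⟨fun i => ((V.equivFinOfCardEq hV).symm i : ℝ × ℝ),
      fun a b h => (V.equivFinOfCardEq hV).symm.injective (Subtype.ext h), fun i => Subtype.prop _⟩
  have huv : ∀ i j, u i ≠ v j := fun i j h =>
    Finset.disjoint_left.1 hUV (huU i) (h ▸ hvV j)
  -- independent closed edges are disjoint
  have hind : ∀ i i' j j', i ≠ i' → j ≠ j' → ∀ s ∈ Set.Icc (0 : ℝ) 1, ∀ t ∈ Set.Icc (0 : ℝ) 1,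
      F (u i) (v j) s ≠ F (u i') (v j') t := by
    intro i i' j j' hi hj s hs t ht heq
    have a0 := (hF (u i) (huU i) (v j) (hvV j)).2.1
    have a1 := (hF (u i) (huU i) (v j) (hvV j)).2.2
    have b0 := (hF (u i') (huU i') (v j') (hvV j')).2.1
    have b1 := (hF (u i') (huU i') (v j') (hvV j')).2.2
    have split : ∀ x ∈ Set.Icc (0 : ℝ) 1, x = 0 ∨ x = 1 ∨ x ∈ Set.Ioo (0 : ℝ) 1 := by
      intro x hx
      rcases hx.1.eq_or_lt with h | h
      · exact Or.inl h.symm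
      · rcases hx.2.eq_or_lt with h' | h'
        · exact Or.inr (Or.inl h')
        · exact Or.inr (Or.inr ⟨h, h'⟩)
    have hout : ∀ i j, ∀ x ∈ Set.Ioo (0 : ℝ) 1, (∀ k, F (u i) (v j) x ≠ u k) ∧
        ∀ k, F (u i) (v j) x ≠ v k := by
      intro i j x hx
      have h := hint (u i) (huU i) (v j) (hvV j)
      constructor
      · intro k hk
        exact Set.eq_empty_iff_forall_notMem.1 h _ ⟨⟨x, hx, hk⟩, Or.inl (huU k)⟩
      · intro k hk
        exact Set.eq_empty_iff_forall_notMem.1 h _ ⟨⟨x, hx, hk⟩, Or.inr (hvV k)⟩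
    rcases split s hs with rfl | rfl | hs'
    · rw [a0] at heq
      rcases split t ht with rfl | rfl | ht'
      · exact hi (hu (heq.trans b0))
      · exact huv _ _ (heq.trans b1)
      · exact (hout i' j' t ht').1 _ heq.symm
    · rw [a1] at heq
      rcases split t ht with rfl | rfl | ht'
      · exact huv _ _ (heq.trans b0).symm
      · exact hj (hv (heq.trans b1))
      · exact (hout i' j' t ht').2 _ heq.symm
    · rcases split t ht with rfl | rfl | ht'
      · exact (hout i j s hs').1 _ (heq.trans b0)
      · exact (hout i j s hs').2 _ (heq.trans b1)
      · have h := hdis (u i) (huU i) (v j) (hvV j) (u i') (huU i') (v j') (hvV j')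
          (fun h => hi (hu (Prod.ext_iff.1 h).1))
        exact Set.eq_empty_iff_forall_notMem.1 h _ ⟨⟨s, hs', rfl⟩, ⟨t, ht', heq.symm⟩⟩
  let e : ℝ × ℝ → ℂ := Complex.equivRealProdCLM.symm
  have he : Function.Injective e := Complex.equivRealProdCLM.symm.injective
  have hec : Continuous e := Complex.equivRealProdCLM.symm.continuous
  let π : ℝ → ℝ := fun t => (Set.projIcc (0 : ℝ) 1 zero_le_one t : ℝ)
  have hπ : ∀ t, π t ∈ Set.Icc (0 : ℝ) 1 := fun t => Subtype.prop _
  have hπc : Continuous π := continuous_subtype_val.comp continuous_projIcc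
  have hπ0 : π 0 = 0 := by simp [π]
  have hπ1 : π 1 = 1 := by simp [π]
  refine K33_core (fun i => e (u i)) (fun j => e (v j)) (fun i j t => e (F (u i) (v j) (π t)))
    ?_ ?_ ?_ ?_
  · intro i j
    exact hec.comp ((hF _ (huU i) _ (hvV j)).1.1.comp_continuous hπc hπ)
  · intro i j
    simp only [hπ0, (hF _ (huU i) _ (hvV j)).2.1]
  · intro i j
    simp only [hπ1, (hF _ (huU i) _ (hvV j)).2.2]
  · intro i i' j j' hi hj s t h
    exact hind i i' j j' hi hj _ (hπ s) _ (hπ t) (he h)
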